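/- There is a dimensional constant ε₀(n) = 1/(2n(n−1)) with the following property: if a homogeneous harmonic polynomial P of degree d ≥ 1 on ℝⁿ satisfies ‖∂ᵢ P‖ ≤ √ε ‖∇P‖ (in normalized L²(∂B(0,1)) norm) for i = 1, …, n−1 with ε < ε₀(n), then d = 1, i.e., P is linear. -/

import Mathlib

open MeasureTheory Metric

noncomputable section

abbrev E (n : ℕ) := EuclideanSpace ℝ (Fin n)

noncomputable def lap (n : ℕ) (f : E n → ℝ) (x : E n) : ℝ :=
  ∑ i : Fin n, fderiv ℝ (fun y => fderiv ℝ f y (EuclideanSpace.single i 1)) x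
    (EuclideanSpace.single i 1)

def IsHHP (n d : ℕ) (P : E n → ℝ) : Prop :=
  (∃ p : MvPolynomial (Fin n) ℝ, p.IsHomogeneous d ∧
      ∀ x : E n, P x = MvPolynomial.eval (fun i => x i) p)
  ∧ ∀ x, lap n P x = 0

noncomputable def sAvg (n : ℕ) (f : E n → ℝ) : ℝ :=
  ⨍ y : sphere (0 : E n) 1, f (y : E n) ∂((volume : Measure (E n)).toSphere)

noncomputable def sInner (n : ℕ) (f g : E n → ℝ) : ℝ := sAvg n (fun x => f x * g x)

noncomputable def sNorm (n : ℕ) (f : E n → ℝ) : ℝ := Real.sqrt (sAvg n fun x => f x ^ 2)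

noncomputable def pd (n : ℕ) (i : Fin n) (f : E n → ℝ) (x : E n) : ℝ :=
  fderiv ℝ f x (EuclideanSpace.single i 1)

/-- The function on Euclidean space defined by a polynomial. -/
def polyFun (n : ℕ) (p : MvPolynomial (Fin n) ℝ) (x : E n) : ℝ :=
  MvPolynomial.eval (fun i => x i) p

/-- The integral of a polynomial against the Gaussian weight `exp (-‖x‖ ^ 2)`. -/
def gaussInt (n : ℕ) (p : MvPolynomial (Fin n) ℝ) : ℝ :=
  ∫ x : E n, polyFun n p x * Real.exp (-‖x‖ ^ 2)

lemma differentiable_polyFun (n : ℕ) (p : MvPolynomial (Fin n) ℝ) :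
    Differentiable ℝ (polyFun n p) := by
  unfold polyFun
  induction p using MvPolynomial.induction_on with
  | C a => simp
  | add p q hp hq => simpa only [map_add] using Differentiable.fun_add hp hq
  | mul_X p i hp =>
    simp only [map_mul, MvPolynomial.eval_X]
    fun_prop

lemma pd_polyFun (n : ℕ) (i : Fin n) (p : MvPolynomial (Fin n) ℝ) :
    pd n i (polyFun n p) = polyFun n (MvPolynomial.pderiv i p) := by
  funext x
  induction p using MvPolynomial.induction_on with
  | C a =>
    have h : polyFun n (MvPolynomial.C a) = fun _ => a := by
      funext y; simp [polyFun]
    simp [pd, h, polyFun]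
  | add p q hp hq =>
    have h : polyFun n (p + q) = polyFun n p + polyFun n q := by
      funext y; simp [polyFun]
    simp only [pd] at hp hq ⊢
    rw [h, fderiv_add (differentiable_polyFun n p x) (differentiable_polyFun n q x)]
    simp [hp, hq, polyFun]
  | mul_X p j hp =>
    have h : polyFun n (p * MvPolynomial.X j) =
        polyFun n p * fun y => EuclideanSpace.proj (𝕜 := ℝ) j y := by
      funext y; simp [polyFun]
    simp only [pd] at hp ⊢
    rw [h, fderiv_mul (differentiable_polyFun n p x)
      (ContinuousLinearMap.differentiableAt _), ContinuousLinearMap.fderiv]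
    by_cases hij : j = i
    · subst hij
      simp [hp, polyFun]
    · simp [hp, polyFun, MvPolynomial.pderiv_X_of_ne hij, hij]

lemma polyFun_injective (n : ℕ) : Function.Injective (polyFun n) := by
  intro p q h
  refine MvPolynomial.funext fun v => ?_
  simpa [polyFun] using congrFun h (WithLp.toLp 2 v)

lemma polyFun_smul {n k : ℕ} {p : MvPolynomial (Fin n) ℝ} (hp : p.IsHomogeneous k) (r : ℝ)
    (x : E n) : polyFun n p (r • x) = r ^ k * polyFun n p x := by
  simp only [polyFun, MvPolynomial.eval_eq', Finset.mul_sum]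
  refine Finset.sum_congr rfl fun m hm => ?_
  have hmk : ∑ i, m i = k := by
    simpa [Finsupp.weight_apply, Finsupp.sum_fintype] using hp (MvPolynomial.mem_support_iff.1 hm)
  simp [mul_pow, Finset.prod_mul_distrib, Finset.prod_pow_eq_pow_sum, hmk, mul_left_comm]

lemma pderiv_pderiv_comm {σ R : Type*} [CommRing R] (i j : σ) (p : MvPolynomial σ R) :
    MvPolynomial.pderiv i (MvPolynomial.pderiv j p) =
      MvPolynomial.pderiv j (MvPolynomial.pderiv i p) := by
  classical
  have h : ⁅MvPolynomial.pderiv (R := R) i, MvPolynomial.pderiv (R := R) j⁆ = 0 := by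
    refine MvPolynomial.derivation_ext fun k => ?_
    rw [Derivation.commutator_apply]
    simp [MvPolynomial.pderiv_X, Pi.single_apply, apply_ite]
  have := congrArg (fun D => D p) h
  simpa [Derivation.commutator_apply, sub_eq_zero] using this

lemma integrable_pow_mul_exp_neg_sq (k : ℕ) :
    Integrable fun x : ℝ => x ^ k * Real.exp (-x ^ 2) := by
  simpa using integrable_rpow_mul_exp_neg_mul_sq one_pos
    (show (-1 : ℝ) < k by have : (0 : ℝ) ≤ k := k.cast_nonneg; linarith)

lemma integrable_polyFun_mul_exp (n : ℕ) (p : MvPolynomial (Fin n) ℝ) :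
    Integrable fun x : E n => polyFun n p x * Real.exp (-‖x‖ ^ 2) := by
  induction p using MvPolynomial.induction_on' with
  | monomial m a =>
    rw [← (PiLp.volume_preserving_toLp (Fin n)).integrable_comp_emb
      (MeasurableEquiv.toLp 2 (Fin n → ℝ)).measurableEmbedding]
    have h := (Integrable.fintype_prod (f := fun i (t : ℝ) => t ^ m i * Real.exp (-t ^ 2))
      fun i => integrable_pow_mul_exp_neg_sq (m i)).const_mul a
    refine h.congr (.of_forall fun v => ?_)
    simp [polyFun, EuclideanSpace.norm_sq_eq, Finset.prod_mul_distrib, ← Real.exp_sum,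
      MvPolynomial.eval_monomial, Finsupp.prod_fintype, mul_assoc]
  | add p q hp hq =>
    refine (hp.add hq).congr (.of_forall fun x => ?_)
    simp [polyFun, add_mul]

lemma gaussInt_add (n : ℕ) (p q : MvPolynomial (Fin n) ℝ) :
    gaussInt n (p + q) = gaussInt n p + gaussInt n q := by
  unfold gaussInt
  rw [← integral_add (integrable_polyFun_mul_exp n p) (integrable_polyFun_mul_exp n q)]
  simp [polyFun, add_mul]

lemma gaussInt_smul (n : ℕ) (a : ℝ) (p : MvPolynomial (Fin n) ℝ) :
    gaussInt n (a • p) = a * gaussInt n p := by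
  unfold gaussInt
  rw [← integral_const_mul]
  simp [polyFun, mul_assoc]

lemma gaussInt_sum {ι : Type*} (n : ℕ) (s : Finset ι) (p : ι → MvPolynomial (Fin n) ℝ) :
    gaussInt n (∑ i ∈ s, p i) = ∑ i ∈ s, gaussInt n (p i) := by
  let L : MvPolynomial (Fin n) ℝ →ₗ[ℝ] ℝ :=
    ⟨⟨gaussInt n, gaussInt_add n⟩, fun a p => gaussInt_smul n a p⟩
  exact map_sum L p s

lemma gaussInt_mono (n : ℕ) {p q : MvPolynomial (Fin n) ℝ}
    (h : ∀ x, polyFun n p x ≤ polyFun n q x) : gaussInt n p ≤ gaussInt n q :=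
  integral_mono (integrable_polyFun_mul_exp n p) (integrable_polyFun_mul_exp n q)
    fun x => mul_le_mul_of_nonneg_right (h x) (Real.exp_nonneg _)

lemma gaussInt_sq_nonneg (n : ℕ) (p : MvPolynomial (Fin n) ℝ) : 0 ≤ gaussInt n (p ^ 2) :=
  integral_nonneg fun x => mul_nonneg (by simp [polyFun, sq_nonneg]) (Real.exp_nonneg _)

lemma eq_zero_of_gaussInt_sq_eq_zero (n : ℕ) {p : MvPolynomial (Fin n) ℝ}
    (h : gaussInt n (p ^ 2) = 0) : p = 0 := by
  have h1 := (integral_eq_zero_iff_of_nonneg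
    (fun x => mul_nonneg (by simp [polyFun, sq_nonneg]) (Real.exp_nonneg _))
    (integrable_polyFun_mul_exp n (p ^ 2))).1 h
  have hc : Continuous fun x : E n => polyFun n (p ^ 2) x * Real.exp (-‖x‖ ^ 2) :=
    (differentiable_polyFun n _).continuous.mul (by fun_prop)
  have h2 := (hc.ae_eq_iff_eq volume continuous_zero).1 h1
  refine polyFun_injective n (funext fun x => ?_)
  simpa [polyFun, Real.exp_ne_zero] using congrFun h2 x

/-- Gaussian integration by parts. -/
lemma gaussInt_pderiv (n : ℕ) (i : Fin n) (p : MvPolynomial (Fin n) ℝ) :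
    gaussInt n (MvPolynomial.pderiv i p) = 2 * gaussInt n (MvPolynomial.X i * p) := by
  have hexp (x : E n) : HasFDerivAt (fun y : E n => Real.exp (-‖y‖ ^ 2))
      (Real.exp (-‖x‖ ^ 2) • -((2 : ℕ) • (innerSL ℝ x : E n →L[ℝ] ℝ))) x :=
    (hasStrictFDerivAt_norm_sq x).hasFDerivAt.neg.exp
  have hd (x : E n) : fderiv ℝ (fun y : E n => Real.exp (-‖y‖ ^ 2)) x
      (EuclideanSpace.single i 1) = -2 * x i * Real.exp (-‖x‖ ^ 2) := by
    rw [(hexp x).fderiv]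
    simp [EuclideanSpace.inner_single_right]
    ring
  have hp (x : E n) : fderiv ℝ (polyFun n p) x (EuclideanSpace.single i 1) =
      polyFun n (MvPolynomial.pderiv i p) x := congrFun (pd_polyFun n i p) x
  have hX (x : E n) : polyFun n p x * (-2 * x i * Real.exp (-‖x‖ ^ 2)) =
      (-2) * (polyFun n (MvPolynomial.X i * p) x * Real.exp (-‖x‖ ^ 2)) := by
    simp [polyFun]
    ring
  have key := integral_mul_fderiv_eq_neg_fderiv_mul_of_integrable (μ := (volume : Measure (E n)))
    (f := polyFun n p) (g := fun y : E n => Real.exp (-‖y‖ ^ 2))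
    (v := EuclideanSpace.single i 1)
    (by simpa only [hp] using integrable_polyFun_mul_exp n _)
    (by simpa only [hd, hX] using (integrable_polyFun_mul_exp n _).const_mul _)
    (integrable_polyFun_mul_exp n p)
    (fun x _ => differentiable_polyFun n p x) (fun x _ => (hexp x).differentiableAt)
  simp only [hp, hd, hX, integral_const_mul] at key
  unfold gaussInt
  linarith

/-- The Gaussian Dirichlet energy of a homogeneous harmonic polynomial. -/
lemma sum_gaussInt_pderiv_sq {n k : ℕ} {q : MvPolynomial (Fin n) ℝ} (hq : q.IsHomogeneous k)
    (hΔ : ∑ i, MvPolynomial.pderiv i (MvPolynomial.pderiv i q) = 0) :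
    ∑ i, gaussInt n (MvPolynomial.pderiv i q ^ 2) = 2 * k * gaussInt n (q ^ 2) := by
  have h1 : ∑ i, MvPolynomial.pderiv i q ^ 2 =
      ∑ i, MvPolynomial.pderiv i (q * MvPolynomial.pderiv i q) := by
    simp only [MvPolynomial.pderiv_mul, Finset.sum_add_distrib, ← Finset.mul_sum, hΔ, sq]
    simp
  have h2 : ∑ i, MvPolynomial.X i * (q * MvPolynomial.pderiv i q) = (k : ℝ) • q ^ 2 := by
    simp only [mul_left_comm _ q, ← Finset.mul_sum, hq.sum_X_mul_pderiv]
    rw [Nat.cast_smul_eq_nsmul, mul_smul_comm, sq]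
  rw [← gaussInt_sum, h1, gaussInt_sum]
  simp only [gaussInt_pderiv, ← Finset.mul_sum]
  rw [← gaussInt_sum, h2, gaussInt_smul]
  ring

/-- On homogeneous polynomials of a fixed degree, the Gaussian integral is a fixed nonnegative
multiple of the spherical average. -/
lemma exists_gaussInt_eq_mul_sAvg {n : ℕ} (hn : n ≠ 0) (m : ℕ) :
    ∃ K : ℝ, 0 ≤ K ∧ ∀ p : MvPolynomial (Fin n) ℝ, p.IsHomogeneous m →
      gaussInt n p = K * sAvg n (polyFun n p) := by
  let μ : Measure (E n) := volume
  let ν := Measure.volumeIoiPow (Module.finrank ℝ (E n) - 1)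
  let φ (r : Set.Ioi (0 : ℝ)) : ℝ := (r : ℝ) ^ m * Real.exp (-(r : ℝ) ^ 2)
  have hφ : 0 ≤ ∫ r, φ r ∂ν :=
    integral_nonneg fun r => mul_nonneg (pow_nonneg (le_of_lt r.2) _) (Real.exp_nonneg _)
  refine ⟨μ.toSphere.real Set.univ * ∫ r, φ r ∂ν, by positivity, fun p hp => ?_⟩
  have hpolar (x : ({0}ᶜ : Set (E n))) :
      polyFun n p x * Real.exp (-‖(x : E n)‖ ^ 2) =
        (fun z : sphere (0 : E n) 1 × Set.Ioi (0 : ℝ) => polyFun n p z.1 * φ z.2)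
          (homeomorphUnitSphereProd (E n) x) := by
    have hx : ‖(x : E n)‖ ≠ 0 := norm_ne_zero_iff.2 x.2
    have : (x : E n) = ‖(x : E n)‖ • (‖(x : E n)‖⁻¹ • (x : E n)) := by
      rw [smul_smul, mul_inv_cancel₀ hx, one_smul]
    simp only [φ, homeomorphUnitSphereProd_apply_fst_coe, homeomorphUnitSphereProd_apply_snd_coe]
    conv_lhs => rw [this, polyFun_smul hp, ← this]
    ring
  calc gaussInt n p
      = ∫ x in ({0}ᶜ : Set (E n)), polyFun n p x * Real.exp (-‖x‖ ^ 2) ∂μ := by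
        unfold gaussInt
        have : Nonempty (Fin n) := ⟨⟨0, Nat.pos_of_ne_zero hn⟩⟩
        rw [restrict_compl_singleton]
    _ = ∫ x : ({0}ᶜ : Set (E n)), polyFun n p x * Real.exp (-‖(x : E n)‖ ^ 2)
          ∂(μ.comap (↑)) := by
        rw [integral_subtype_comap (measurableSet_singleton _).compl
          fun x : E n => polyFun n p x * Real.exp (-‖x‖ ^ 2)]
    _ = ∫ z, polyFun n p z.1 * φ z.2 ∂(μ.toSphere.prod ν) := by
        simp only [hpolar]
        exact μ.measurePreserving_homeomorphUnitSphereProd.integral_comp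
          (Homeomorph.measurableEmbedding _)
          (fun z : sphere (0 : E n) 1 × Set.Ioi (0 : ℝ) => polyFun n p z.1 * φ z.2)
    _ = (∫ y, polyFun n p (y : E n) ∂μ.toSphere) * ∫ r, φ r ∂ν :=
        integral_prod_mul (fun y : sphere (0 : E n) 1 => polyFun n p (y : E n)) φ
    _ = _ := by
        rw [← measure_smul_average μ.toSphere fun y => polyFun n p (y : E n), smul_eq_mul]
        unfold sAvg
        ring

/-- A nonnegative symmetric array whose row sums are `c * a j`, with one diagonal entry
dominated by the others: smallness of all but one `a j` forces `a = 0`. -/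
lemma eq_zero_of_row_sums {ι : Type*} [Fintype ι] [DecidableEq ι] (l : ι) {N c ε : ℝ}
    (hN : (Fintype.card ι : ℝ) = N) (hN2 : 2 ≤ N) (hc : 0 < c) {a : ι → ℝ} {h : ι → ι → ℝ}
    (ha : ∀ i, 0 ≤ a i) (hh : ∀ i j, 0 ≤ h i j) (hsymm : ∀ i j, h i j = h j i)
    (hrow : ∀ j, ∑ i, h i j = c * a j)
    (hdiag : h l l ≤ (N - 1) * ∑ i ∈ Finset.univ.erase l, h i i)
    (hε0 : 0 ≤ ε) (hε : ε < 1 / (2 * N * (N - 1)))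
    (hsmall : ∀ i ≠ l, a i ≤ ε * ∑ j, a j) (i : ι) : a i = 0 := by
  set A := ∑ i ∈ Finset.univ.erase l, a i with hA
  have hA0 : 0 ≤ A := Finset.sum_nonneg fun i _ => ha i
  have htot : ∑ j, a j = a l + A := (Finset.add_sum_erase _ a (Finset.mem_univ l)).symm
  have hcard : ((Finset.univ.erase l).card : ℝ) = N - 1 := by
    rw [Finset.card_erase_of_mem (Finset.mem_univ l), Finset.card_univ,
      Nat.cast_sub (Fintype.card_pos_iff.2 ⟨l⟩), hN, Nat.cast_one]
  have hpair : ∑ i ∈ Finset.univ.erase l, (h i i + h i l) ≤ c * A := by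
    rw [hA, Finset.mul_sum]
    refine Finset.sum_le_sum fun i hi => ?_
    rw [← hrow i, hsymm i l, ← Finset.sum_pair (f := fun k => h k i) (Finset.ne_of_mem_erase hi)]
    exact Finset.sum_le_sum_of_subset_of_nonneg (Finset.subset_univ _) fun k _ _ => hh k i
  rw [Finset.sum_add_distrib] at hpair
  have hl : h l l + ∑ i ∈ Finset.univ.erase l, h i l = c * a l := by
    rw [← hrow l, Finset.add_sum_erase _ (fun i => h i l) (Finset.mem_univ l)]
  have hB : 0 ≤ ∑ i ∈ Finset.univ.erase l, h i l := Finset.sum_nonneg fun i _ => hh i l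
  have hal : a l ≤ (N - 1) * A := by
    refine le_of_mul_le_mul_left ?_ hc
    nlinarith
  have hAle : A ≤ (N - 1) * (ε * (a l + A)) := by
    calc A ≤ ∑ i ∈ Finset.univ.erase l, ε * (a l + A) :=
          Finset.sum_le_sum fun i hi => htot ▸ hsmall i (Finset.ne_of_mem_erase hi)
      _ = _ := by rw [Finset.sum_const, nsmul_eq_mul, hcard]
  have hε' : ε * (2 * N * (N - 1)) < 1 := (lt_div_iff₀ (by nlinarith)).1 hε
  have hAN : A ≤ (N - 1) * (ε * (N * A)) := by
    refine hAle.trans ?_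
    have : 0 ≤ N - 1 := by linarith
    gcongr
    linarith
  have hAz : A = 0 := by nlinarith
  have halz : a l = 0 := le_antisymm (by simpa [hAz] using hal) (ha l)
  by_cases hi : i = l
  · rw [hi, halz]
  · exact (Finset.sum_eq_zero_iff_of_nonneg fun i _ => ha i).1 hAz i
      (Finset.mem_erase.2 ⟨hi, Finset.mem_univ i⟩)

theorem stmt17 (n : ℕ) (hn : 2 ≤ n) :
    ∀ (d : ℕ), 1 ≤ d → ∀ (P : E n → ℝ), IsHHP n d P →
      (∃ x y : E n, P x ≠ P y) →
      ∀ ε : ℝ, 0 ≤ ε → ε < 1 / (2 * (n : ℝ) * ((n : ℝ) - 1)) →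
        (∀ i : Fin n, (i : ℕ) < n - 1 →
          sNorm n (pd n i P) ≤ Real.sqrt ε *
            Real.sqrt (∑ j : Fin n, (sNorm n (pd n j P)) ^ 2)) →
        d = 1 := by
  rintro d hd P ⟨⟨p, hp, hPp⟩, hΔ⟩ ⟨x, y, hxy⟩ ε hε0 hε hsmall
  by_contra hd1
  obtain rfl : P = polyFun n p := funext hPp
  have hlap : ∑ i, MvPolynomial.pderiv i (MvPolynomial.pderiv i p) = 0 := by
    refine polyFun_injective n (funext fun x => ?_)
    have h := hΔ x
    have h2 (i : Fin n) : pd n i (pd n i (polyFun n p)) x =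
        polyFun n (MvPolynomial.pderiv i (MvPolynomial.pderiv i p)) x := by
      rw [pd_polyFun, pd_polyFun]
    change ∑ i, pd n i (pd n i (polyFun n p)) x = 0 at h
    simp only [h2] at h
    simpa [polyFun] using h
  have hlap' (j : Fin n) : ∑ i, MvPolynomial.pderiv i (MvPolynomial.pderiv i
      (MvPolynomial.pderiv j p)) = 0 := by
    have h := congrArg (MvPolynomial.pderiv j) hlap
    rw [map_sum, map_zero] at h
    rw [← h]
    refine Finset.sum_congr rfl fun i _ => ?_
    rw [pderiv_pderiv_comm i j p, pderiv_pderiv_comm i j]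
  obtain ⟨K, hK0, hK⟩ := exists_gaussInt_eq_mul_sAvg (n := n) (by omega) ((d - 1) * 2)
  have hKs (j : Fin n) : gaussInt n (MvPolynomial.pderiv j p ^ 2) =
      K * sNorm n (pd n j (polyFun n p)) ^ 2 := by
    rw [hK _ (hp.pderiv.pow 2), sNorm, Real.sq_sqrt, pd_polyFun]
    · exact congrArg (fun f => K * sAvg n f) (funext fun y => by simp [polyFun])
    · exact integral_nonneg fun y => sq_nonneg _
  let l : Fin n := ⟨n - 1, by omega⟩
  have hN2 : (2 : ℝ) ≤ n := by exact_mod_cast hn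
  have hd2 : (1 : ℝ) ≤ (d - 1 : ℕ) := by exact_mod_cast (by omega : 1 ≤ d - 1)
  have hzero := eq_zero_of_row_sums l (N := n) (c := 2 * (d - 1 : ℕ)) (ε := ε) (by simp) hN2
    (by positivity)
    (a := fun j => gaussInt n (MvPolynomial.pderiv j p ^ 2))
    (h := fun i j => gaussInt n (MvPolynomial.pderiv i (MvPolynomial.pderiv j p) ^ 2))
    (fun j => gaussInt_sq_nonneg n _) (fun i j => gaussInt_sq_nonneg n _)
    (fun i j => by rw [pderiv_pderiv_comm]) (fun j => sum_gaussInt_pderiv_sq hp.pderiv (hlap' j))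
    ?_ hε0 hε ?_
  · have hp0 : (d : ℝ) • p = 0 := by
      rw [Nat.cast_smul_eq_nsmul, ← hp.sum_X_mul_pderiv]
      exact Finset.sum_eq_zero fun i _ => by
        rw [eq_zero_of_gaussInt_sq_eq_zero n (hzero i), mul_zero]
    have : p = 0 := (smul_eq_zero.1 hp0).resolve_left (by positivity)
    exact hxy (by simp [this, polyFun])
  · rw [← gaussInt_sum, ← gaussInt_smul]
    refine gaussInt_mono n fun x => ?_
    rw [← Finset.add_sum_erase _ _ (Finset.mem_univ l)] at hlap
    have hcard : ((n - 1 : ℕ) : ℝ) = n - 1 := by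
      rw [Nat.cast_sub (by omega), Nat.cast_one]
    rw [eq_neg_of_add_eq_zero_left hlap, neg_sq]
    simpa [polyFun, hcard] using sq_sum_le_card_mul_sum_sq (s := Finset.univ.erase l)
      (f := fun i => polyFun n (MvPolynomial.pderiv i (MvPolynomial.pderiv i p)) x)
  · intro i hi
    have hil : (i : ℕ) < n - 1 := by
      have : (i : ℕ) ≠ n - 1 := fun h => hi (Fin.ext h)
      omega
    have h := pow_le_pow_left₀ (Real.sqrt_nonneg _) (hsmall i hil) 2
    rw [mul_pow, Real.sq_sqrt hε0,
      Real.sq_sqrt (Finset.sum_nonneg fun j _ => sq_nonneg _)] at h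
    simp only [hKs, ← Finset.mul_sum]
    rw [mul_left_comm]
    exact mul_le_mul_of_nonneg_left h hK0
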